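/- (Lemma 1, specialized.) Let η > 0 and let X*(η) be the unique minimizer of X ↦ ⟨C,X⟩ + η·Σ_{i,j} X_{ij} log X_{ij} over 𝒫. If η ≤ Δ/(1 + log(mn)), then the ℓ1-distance from X*(η) to the optimal face satisfies min_{X∈𝒳} ‖X*(η) − X‖_1 ≤ 2·exp(−Δ/η + 1 + log(mn)); in particular it is at most 6mn·exp(−Δ/η). -/

import Mathlib

open scoped BigOperators

/-- The trace inner product `⟨A,B⟩ = Σ_{i,j} A_{ij} B_{ij}`. -/
def inprod {m n : ℕ} (A B : Matrix (Fin m) (Fin n) ℝ) : ℝ :=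
  ∑ i, ∑ j, A i j * B i j

/-- The transport polytope
`𝒫 = {X : X_{ij} ≥ 0, X e_n = a, Xᵀ e_m = b}` (row sums `a`, column sums `b`). -/
def Pset {m n : ℕ} (a : Fin m → ℝ) (b : Fin n → ℝ) : Set (Matrix (Fin m) (Fin n) ℝ) :=
  {X | (∀ i j, 0 ≤ X i j) ∧ (∀ i, ∑ j, X i j = a i) ∧ (∀ j, ∑ i, X i j = b j)}

theorem mul_log_add_mul_log_le {p q : ℝ} (hp : 0 ≤ p) (hq : 0 ≤ q) :
    p * Real.log p + q * Real.log q ≤ (p + q) * Real.log (p + q) := by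
  rcases hp.eq_or_lt with rfl | hp
  · simp
  rcases hq.eq_or_lt with rfl | hq
  · simp
  have h₁ := mul_le_mul_of_nonneg_left (Real.log_le_log hp (by linarith : p ≤ p + q)) hp.le
  have h₂ := mul_le_mul_of_nonneg_left (Real.log_le_log hq (by linarith : q ≤ p + q)) hq.le
  linarith

theorem mul_mul_log_mul (x y : ℝ) :
    x * y * Real.log (x * y) = y * (x * Real.log x) + x * (y * Real.log y) := by
  have h := Real.negMulLog_mul x y
  simp only [Real.negMulLog] at h
  linarith

theorem sub_inv_sub_mul_log_le_mul_log {z N : ℝ} (hz : 0 ≤ z) (hN : 0 < N) :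
    z - N⁻¹ - z * Real.log N ≤ z * Real.log z := by
  rcases hz.eq_or_lt with rfl | hz
  · simpa using hN.le
  have h := mul_le_mul_of_nonneg_left (Real.one_sub_inv_le_log_of_pos (mul_pos hN hz)) hz.le
  rw [Real.log_mul hN.ne' hz.ne', mul_inv] at h
  have h' : z * (1 - N⁻¹ * z⁻¹) = z - N⁻¹ := by field_simp
  linarith

/-- Lower bound on the change of `u ↦ u log u` when moving from `x` a fraction `t` towards `z`. -/
theorem mul_log_convexCombination_lower_bound {x z t N : ℝ} (hx : 0 ≤ x) (hx1 : x ≤ 1)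
    (hz : 0 ≤ z) (ht : 0 ≤ t) (ht1 : t ≤ 1) (hN : 0 < N) :
    x * Real.log x - t * x + t * Real.log t * z + t * (1 - Real.log N) * z - t * N⁻¹
      ≤ ((1 - t) * x + t * z) * Real.log ((1 - t) * x + t * z) := by
  have ht' : 0 ≤ 1 - t := sub_nonneg.2 ht1
  have hsuper := mul_log_add_mul_log_le (mul_nonneg ht' hx) (mul_nonneg ht hz)
  rw [mul_mul_log_mul, mul_mul_log_mul] at hsuper
  have hxlog : t * (x * Real.log x) ≤ 0 :=
    mul_nonpos_of_nonneg_of_nonpos ht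
      (mul_nonpos_of_nonneg_of_nonpos hx (Real.log_nonpos hx hx1))
  have htlog : x * (-t) ≤ x * ((1 - t) * Real.log (1 - t)) := by
    refine mul_le_mul_of_nonneg_left ?_ hx
    have h := sub_inv_sub_mul_log_le_mul_log ht' one_pos
    simp only [inv_one, Real.log_one, mul_zero] at h
    linarith
  have hzlog := mul_le_mul_of_nonneg_left (sub_inv_sub_mul_log_le_mul_log hz hN) ht
  linarith

theorem isCompact_convexJoin {E : Type*} [AddCommGroup E] [Module ℝ E] [TopologicalSpace E]
    [ContinuousAdd E] [ContinuousSMul ℝ E] {s t : Set E} (hs : IsCompact s) (ht : IsCompact t) :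
    IsCompact (convexJoin ℝ s t) := by
  have h : convexJoin ℝ s t =
      (fun p : ℝ × E × E => (1 - p.1) • p.2.1 + p.1 • p.2.2) '' (Set.Icc 0 1 ×ˢ s ×ˢ t) := by
    ext w
    simp only [mem_convexJoin, segment_eq_image, Set.mem_image, Set.mem_prod, Prod.exists]
    constructor
    · rintro ⟨x, hx, z, hz, r, hr, rfl⟩
      exact ⟨r, x, z, ⟨hr, hx, hz⟩, rfl⟩
    · rintro ⟨r, x, z, ⟨hr, hx, hz⟩, rfl⟩
      exact ⟨x, hx, z, hz, r, hr, rfl⟩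
  rw [h]
  exact (isCompact_Icc.prod (hs.prod ht)).image (by fun_prop)

/-- If every extreme point of a compact convex set lies in one of two compact convex subsets, then
the set is contained in the join of the two. -/
theorem subset_convexJoin_of_extremePoints_subset {E : Type*} [AddCommGroup E] [Module ℝ E]
    [TopologicalSpace E] [T2Space E] [IsTopologicalAddGroup E] [ContinuousSMul ℝ E]
    [LocallyConvexSpace ℝ E] {K s t : Set E} (hK : IsCompact K) (hKc : Convex ℝ K)
    (hs : IsCompact s) (hsc : Convex ℝ s) (hs₀ : s.Nonempty)
    (ht : IsCompact t) (htc : Convex ℝ t) (ht₀ : t.Nonempty)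
    (hext : K.extremePoints ℝ ⊆ s ∪ t) : K ⊆ convexJoin ℝ s t := by
  rw [← closure_convexHull_extremePoints hK hKc]
  refine closure_minimal ?_ (isCompact_convexJoin hs ht).isClosed
  rw [← hsc.convexHull_union htc hs₀ ht₀]
  exact convexHull_mono hext

section Transport

variable {m n : ℕ} {a : Fin m → ℝ} {b : Fin n → ℝ}

theorem inprod_add_smul (C X Y : Matrix (Fin m) (Fin n) ℝ) (r s : ℝ) :
    inprod C (r • X + s • Y) = r * inprod C X + s * inprod C Y := by
  simp only [inprod, Matrix.add_apply, Matrix.smul_apply, smul_eq_mul, Finset.mul_sum,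
    ← Finset.sum_add_distrib]
  exact Finset.sum_congr rfl fun i _ => Finset.sum_congr rfl fun j _ => by ring

theorem continuous_inprod (C : Matrix (Fin m) (Fin n) ℝ) : Continuous (inprod C) := by
  unfold inprod
  fun_prop

theorem sum_sum_eq_of_mem_Pset {X : Matrix (Fin m) (Fin n) ℝ} (hX : X ∈ Pset a b) :
    ∑ i, ∑ j, X i j = ∑ i, a i :=
  Finset.sum_congr rfl fun i _ => hX.2.1 i

theorem le_sum_of_mem_Pset {X : Matrix (Fin m) (Fin n) ℝ} (hX : X ∈ Pset a b) (i : Fin m)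
    (j : Fin n) : X i j ≤ ∑ i, a i :=
  calc X i j ≤ ∑ j, X i j := Finset.single_le_sum (fun j _ => hX.1 i j) (Finset.mem_univ j)
    _ ≤ ∑ i, ∑ j, X i j := Finset.single_le_sum (f := fun i => ∑ j, X i j)
        (fun i _ => Finset.sum_nonneg fun j _ => hX.1 i j) (Finset.mem_univ i)
    _ = ∑ i, a i := sum_sum_eq_of_mem_Pset hX

theorem convex_Pset : Convex ℝ (Pset a b) := by
  rintro X ⟨hX, hXa, hXb⟩ Y ⟨hY, hYa, hYb⟩ r s hr hs hrs
  refine ⟨fun i j => ?_, fun i => ?_, fun j => ?_⟩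
  · exact add_nonneg (mul_nonneg hr (hX i j)) (mul_nonneg hs (hY i j))
  · simp [Finset.sum_add_distrib, ← Finset.mul_sum, hXa, hYa, ← add_mul, hrs]
  · simp [Finset.sum_add_distrib, ← Finset.mul_sum, hXb, hYb, ← add_mul, hrs]

theorem isClosed_Pset : IsClosed (Pset a b) := by
  simp only [Pset, Set.ofPred_and, Set.ofPred_forall]
  refine .inter ?_ (.inter ?_ ?_)
  · exact isClosed_iInter fun i => isClosed_iInter fun j =>
      isClosed_le continuous_const (by fun_prop)
  · exact isClosed_iInter fun i => isClosed_eq (by fun_prop) continuous_const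
  · exact isClosed_iInter fun j => isClosed_eq (by fun_prop) continuous_const

theorem isCompact_Pset : IsCompact (Pset a b) := by
  have hbox : IsCompact (Set.univ.pi fun _ : Fin m => Set.univ.pi fun _ : Fin n =>
      Set.Icc 0 (∑ i, a i)) :=
    isCompact_univ_pi fun _ => isCompact_univ_pi fun _ => isCompact_Icc
  exact IsCompact.of_isClosed_subset hbox isClosed_Pset fun X hX i _ j _ =>
    ⟨hX.1 i j, le_sum_of_mem_Pset hX i j⟩

/-- Every point of the transport polytope is a convex combination of an optimal point and a point
whose cost is suboptimal by at least the gap over extreme points. -/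
theorem exists_convexCombination_of_mem_Pset {C : Matrix (Fin m) (Fin n) ℝ} {c Δ : ℝ}
    (hc : IsLeast ((fun X => inprod C X) '' Pset a b) c)
    (hΔ : IsLeast {d : ℝ | ∃ v ∈ Set.extremePoints ℝ (Pset a b),
      c < inprod C v ∧ d = inprod C v - c} Δ)
    {X : Matrix (Fin m) (Fin n) ℝ} (hX : X ∈ Pset a b) :
    ∃ x ∈ Pset a b, inprod C x = c ∧ ∃ z ∈ Pset a b, c + Δ ≤ inprod C z ∧
      ∃ t : ℝ, 0 ≤ t ∧ t ≤ 1 ∧ X = (1 - t) • x + t • z := by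
  have : LocallyConvexSpace ℝ (Matrix (Fin m) (Fin n) ℝ) :=
    inferInstanceAs (LocallyConvexSpace ℝ (Fin m → Fin n → ℝ))
  have hs : IsCompact (Pset a b ∩ {X | inprod C X = c}) :=
    isCompact_Pset.inter_right (isClosed_eq (continuous_inprod C) continuous_const)
  have ht : IsCompact (Pset a b ∩ {X | c + Δ ≤ inprod C X}) :=
    isCompact_Pset.inter_right (isClosed_le continuous_const (continuous_inprod C))
  have hsc : Convex ℝ (Pset a b ∩ {X | inprod C X = c}) := by
    refine convex_Pset.inter fun X hX Y hY r s _ _ hrs => ?_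
    simp only [Set.mem_ofPred_eq] at *
    rw [inprod_add_smul, hX, hY, ← add_mul, hrs, one_mul]
  have htc : Convex ℝ (Pset a b ∩ {X | c + Δ ≤ inprod C X}) := by
    refine convex_Pset.inter fun X hX Y hY r s hr hs hrs => ?_
    simp only [Set.mem_ofPred_eq] at *
    rw [inprod_add_smul, ← one_mul (c + Δ), ← hrs, add_mul]
    gcongr
  obtain ⟨X₀, hX₀, hX₀c⟩ := hc.1
  obtain ⟨v, hv, -, hvΔ⟩ := hΔ.1
  have hext : (Pset a b).extremePoints ℝ ⊆
      (Pset a b ∩ {X | inprod C X = c}) ∪ (Pset a b ∩ {X | c + Δ ≤ inprod C X}) := by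
    intro w hw
    rcases (hc.2 ⟨w, hw.1, rfl⟩ : c ≤ inprod C w).eq_or_lt with h | h
    · exact .inl ⟨hw.1, h.symm⟩
    · exact .inr ⟨hw.1, le_sub_iff_add_le'.1 (hΔ.2 ⟨w, hw, h, rfl⟩)⟩
  obtain ⟨x, hx, z, hz, hseg⟩ := mem_convexJoin.1 <|
    subset_convexJoin_of_extremePoints_subset isCompact_Pset convex_Pset hs hsc
      ⟨X₀, hX₀, hX₀c⟩ ht htc ⟨v, hv.1, (by simp [hvΔ] : c + Δ ≤ inprod C v)⟩ hext hX
  rw [segment_eq_image] at hseg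
  obtain ⟨t, ht, rfl⟩ := hseg
  exact ⟨x, hx.1, hx.2, z, hz.1, hz.2, t, ht.1, ht.2, rfl⟩

theorem sum_mul_log_convexCombination_lower_bound (hm : 0 < m) (hn : 0 < n)
    (hasum : ∑ i, a i = 1) {x z : Matrix (Fin m) (Fin n) ℝ} (hx : x ∈ Pset a b)
    (hz : z ∈ Pset a b) {t : ℝ} (ht : 0 ≤ t) (ht1 : t ≤ 1) :
    ∑ i, ∑ j, x i j * Real.log (x i j) + t * (Real.log t - 1 - Real.log ((m : ℝ) * n))
      ≤ ∑ i, ∑ j, ((1 - t) • x + t • z) i j * Real.log (((1 - t) • x + t • z) i j) := by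
  have hN : (0 : ℝ) < (m : ℝ) * n := by positivity
  have h := Finset.sum_le_sum fun i (_ : i ∈ Finset.univ) =>
    Finset.sum_le_sum fun j (_ : j ∈ Finset.univ) =>
      mul_log_convexCombination_lower_bound (hx.1 i j) (hasum ▸ le_sum_of_mem_Pset hx i j)
        (hz.1 i j) ht ht1 hN
  simp only [Finset.sum_sub_distrib, Finset.sum_add_distrib, ← Finset.mul_sum,
    sum_sum_eq_of_mem_Pset hx, sum_sum_eq_of_mem_Pset hz, hasum, Finset.sum_const,
    Finset.card_univ, Fintype.card_fin, nsmul_eq_mul] at h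
  have hcancel : (m : ℝ) * (n * (t * ((m : ℝ) * n)⁻¹)) = t := by
    field_simp
  simp only [Matrix.add_apply, Matrix.smul_apply, smul_eq_mul]
  linarith

theorem sum_abs_convexCombination_sub_le (hasum : ∑ i, a i = 1)
    {x z : Matrix (Fin m) (Fin n) ℝ} (hx : x ∈ Pset a b) (hz : z ∈ Pset a b) {t : ℝ}
    (ht : 0 ≤ t) : ∑ i, ∑ j, |((1 - t) • x + t • z) i j - x i j| ≤ 2 * t := by
  have h : ∀ i j, |((1 - t) • x + t • z) i j - x i j| ≤ t * (z i j + x i j) := by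
    intro i j
    simp only [Matrix.add_apply, Matrix.smul_apply, smul_eq_mul]
    rw [show (1 - t) * x i j + t * z i j - x i j = t * (z i j - x i j) by ring, abs_mul,
      abs_of_nonneg ht]
    refine mul_le_mul_of_nonneg_left ?_ ht
    rw [abs_le]
    constructor <;> linarith [hx.1 i j, hz.1 i j]
  refine (Finset.sum_le_sum fun i _ => Finset.sum_le_sum fun j _ => h i j).trans_eq ?_
  simp only [← Finset.mul_sum, Finset.sum_add_distrib, sum_sum_eq_of_mem_Pset hx,
    sum_sum_eq_of_mem_Pset hz, hasum]
  ring

end Transport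

/-- Lemma 1 (specialized): if `η ≤ Δ/(1 + log(mn))`, the ℓ1-distance from the unique
entropic minimizer `X*(η)` to the optimal face `𝒳` is at most
`2 exp(−Δ/η + 1 + log(mn))`, hence at most `6mn exp(−Δ/η)`. Here
`c* = min_{X∈𝒫}⟨C,X⟩`, `𝒳 = {X ∈ 𝒫 : ⟨C,X⟩ = c*}`, and `Δ` is the minimal
suboptimality gap `⟨C,v⟩ − c*` over extreme points `v` of `𝒫` with `⟨C,v⟩ > c*`. -/
theorem stmt_14 {m n : ℕ} (hm : 0 < m) (hn : 0 < n)
    (a : Fin m → ℝ) (b : Fin n → ℝ)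
    (ha : ∀ i, 0 < a i) (hb : ∀ j, 0 < b j)
    (hasum : ∑ i, a i = 1) (hbsum : ∑ j, b j = 1)
    (C : Matrix (Fin m) (Fin n) ℝ)
    (cstar : ℝ) (hc : IsLeast ((fun X => inprod C X) '' Pset a b) cstar)
    (Δ : ℝ)
    (hΔ : IsLeast
      {d : ℝ | ∃ v ∈ Set.extremePoints ℝ (Pset a b),
        cstar < inprod C v ∧ d = inprod C v - cstar} Δ)
    (η : ℝ) (hη : 0 < η)
    (Xs : Matrix (Fin m) (Fin n) ℝ) (hXsP : Xs ∈ Pset a b)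
    (hXsmin : ∀ X ∈ Pset a b,
      inprod C Xs + η * ∑ i, ∑ j, Xs i j * Real.log (Xs i j)
        ≤ inprod C X + η * ∑ i, ∑ j, X i j * Real.log (X i j))
    (hXsuniq : ∀ Y ∈ Pset a b,
      (∀ X ∈ Pset a b,
        inprod C Y + η * ∑ i, ∑ j, Y i j * Real.log (Y i j)
          ≤ inprod C X + η * ∑ i, ∑ j, X i j * Real.log (X i j)) → Y = Xs)
    (hsmall : η ≤ Δ / (1 + Real.log ((m : ℝ) * n))) :
    ∃ X ∈ Pset a b, inprod C X = cstar ∧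
      (∑ i, ∑ j, |Xs i j - X i j|)
        ≤ 2 * Real.exp (-Δ / η + 1 + Real.log ((m : ℝ) * n)) ∧
      (∑ i, ∑ j, |Xs i j - X i j|)
        ≤ 6 * (m : ℝ) * n * Real.exp (-Δ / η) := by
  obtain ⟨x, hx, hxc, z, hz, hzc, t, ht, ht1, rfl⟩ :=
    exists_convexCombination_of_mem_Pset hc hΔ hXsP
  have hdist := sum_abs_convexCombination_sub_le hasum hx hz ht
  have hweight : t ≤ Real.exp (-Δ / η + 1 + Real.log ((m : ℝ) * n)) := by
    rcases ht.eq_or_lt with rfl | htpos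
    · positivity
    have hent := mul_le_mul_of_nonneg_left
      (sum_mul_log_convexCombination_lower_bound hm hn hasum hx hz ht ht1) hη.le
    have hopt := hXsmin x hx
    rw [inprod_add_smul, hxc] at hopt
    have hcost := mul_le_mul_of_nonneg_left hzc ht
    have hgap : t * (Δ + η * (Real.log t - 1 - Real.log ((m : ℝ) * n))) ≤ 0 := by linarith
    have hlog := nonpos_of_mul_nonpos_right hgap htpos
    rw [← Real.log_le_iff_le_exp htpos]
    have hdiv : Δ / η ≤ -(Real.log t - 1 - Real.log ((m : ℝ) * n)) := by
      rw [div_le_iff₀ hη]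
      linarith
    rw [neg_div]
    linarith
  have hbound : ∑ i, ∑ j, |((1 - t) • x + t • z) i j - x i j|
      ≤ 2 * Real.exp (-Δ / η + 1 + Real.log ((m : ℝ) * n)) := by linarith
  refine ⟨x, hx, hxc, hbound, hbound.trans ?_⟩
  have hN : (0 : ℝ) < (m : ℝ) * n := by positivity
  rw [Real.exp_add, Real.exp_add, Real.exp_log hN]
  have hexp := mul_le_mul_of_nonneg_left Real.exp_one_lt_three.le
    (mul_pos (Real.exp_pos (-Δ / η)) hN).le
  linarith
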